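/- Let g ≥ 1 and r ≥ 2 be integers with d_max(g,r) ≤ g − 1, and set d = d_max(g,r). Then κ(g,r,d) = g + r + 2 + ⌊−gr/(r+1)⌋ + ⌊−2√(r + 1 − (g mod (r+1)))⌋, where g mod (r+1) denotes the representative in {0, 1, …, r}. -/

import Mathlib

noncomputable section

/-- The Brill--Noether number `ρ(g,r,d) = g - (r+1)(g-d+r)`. -/
def rho (g r d : ℤ) : ℤ := g - (r + 1) * (g - d + r)

/-- Pflueger's Brill--Noether number `ρ_k(g,r,d)`, the maximum of
`ρ(g,r-ℓ,d) - ℓk` over integers `0 ≤ ℓ ≤ min r (g-d+r-1)`. -/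
def rhoK (g r d k : ℤ) : ℤ :=
  sSup ((fun ℓ : ℤ => rho g (r - ℓ) d - ℓ * k) '' Set.Icc 0 (min r (g - d + r - 1)))

/-- `κ(g,r,d)`: the greatest integer `k ≥ 1` such that `ρ_k(g,r,d) ≥ 0`. -/
def kappa (g r d : ℤ) : ℤ := sSup {k : ℤ | 1 ≤ k ∧ 0 ≤ rhoK g r d k}

/-- `d_max(g,r) = r + ⌈gr/(r+1)⌉ - 1`, the largest `d` with `ρ(g,r,d) < 0`. -/
def dmax (g r : ℤ) : ℤ := r + ⌈((g : ℚ) * r) / ((r : ℚ) + 1)⌉ - 1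

/-- `ρ_k ≥ 0` exactly when one of the competing terms is nonnegative. -/
lemma rhoK_nonneg_iff {g r d k : ℤ} (h : 0 ≤ min r (g - d + r - 1)) :
    0 ≤ rhoK g r d k ↔
      ∃ ℓ ∈ Set.Icc 0 (min r (g - d + r - 1)), 0 ≤ rho g (r - ℓ) d - ℓ * k := by
  have hfin := (Set.finite_Icc 0 (min r (g - d + r - 1))).image
    (fun ℓ : ℤ => rho g (r - ℓ) d - ℓ * k)
  have hne : (Set.Icc 0 (min r (g - d + r - 1))).Nonempty := ⟨0, le_rfl, h⟩
  unfold rhoK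
  constructor
  · intro hk
    obtain ⟨ℓ, hℓ, heq⟩ := (hne.image _).csSup_mem hfin
    exact ⟨ℓ, hℓ, hk.trans_eq heq.symm⟩
  · rintro ⟨ℓ, hℓ, hk⟩
    exact hk.trans (le_csSup hfin.bddAbove ⟨ℓ, hℓ, rfl⟩)

lemma floor_neg_mul_div_add_one {g r : ℤ} (hr : 0 ≤ r) :
    ⌊(-((g : ℚ) * r)) / ((r : ℚ) + 1)⌋ = g / (r + 1) - g := by
  lift r to ℕ using hr
  have hfloor := Rat.floor_intCast_div_natCast g (r + 1)
  push_cast at hfloor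
  have h : (-((g : ℚ) * r)) / ((r : ℚ) + 1) = (g : ℚ) / (r + 1) - g := by
    field_simp
    ring
  rw [Int.cast_natCast, h, Int.floor_sub_intCast, hfloor]

lemma dmax_eq {g r : ℤ} (hr : 0 ≤ r) : dmax g r = r + (g - g / (r + 1)) - 1 := by
  have h := floor_neg_mul_div_add_one (g := g) hr
  rw [neg_div, Int.floor_neg] at h
  unfold dmax
  lia

/-- An integer `t` is at least `2√s` exactly when it is nonnegative and `4s ≤ t²`. -/
lemma ceil_two_mul_sqrt_le_iff {s t : ℤ} :
    ⌈(2 : ℝ) * √(s : ℝ)⌉ ≤ t ↔ 0 ≤ t ∧ 4 * s ≤ t ^ 2 := by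
  have h : (2 : ℝ) * √(s : ℝ) = √((4 * s : ℤ) : ℝ) := by
    push_cast
    rw [Real.sqrt_mul (by norm_num), show (4 : ℝ) = 2 ^ 2 by norm_num,
      Real.sqrt_sq (by norm_num)]
  rw [Int.ceil_le, h, Real.sqrt_le_iff]
  norm_cast

theorem stmt9 (g r : ℤ) (hg : 1 ≤ g) (hr : 2 ≤ r) (hd : dmax g r ≤ g - 1) :
    kappa g r (dmax g r) =
      g + r + 2 + ⌊(-((g : ℚ) * r)) / ((r : ℚ) + 1)⌋ +
        ⌊(-2 : ℝ) * Real.sqrt ((r + 1 - g % (r + 1) : ℤ) : ℝ)⌋ := by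
  have hr0 : 0 ≤ r := by lia
  rw [dmax_eq hr0] at hd ⊢
  rw [floor_neg_mul_div_add_one hr0, neg_mul, Int.floor_neg]
  have hdiv := Int.mul_ediv_add_emod g (r + 1)
  have hmod0 := Int.emod_nonneg g (by lia : r + 1 ≠ 0)
  have hmod1 := Int.emod_lt_of_pos g (by lia : 0 < r + 1)
  set q := g / (r + 1)
  set m := g % (r + 1)
  set s : ℤ := r + 1 - m with hs
  set t := ⌈(2 : ℝ) * √(s : ℝ)⌉ with ht
  have hq : r ≤ q := by lia
  have hmin : min r (g - (r + (g - q) - 1) + r - 1) = r := min_eq_left (by lia)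
  have hterm (k ℓ : ℤ) : rho g (r - ℓ) (r + (g - q) - 1) - ℓ * k =
      ℓ * (r + q + 2 - k - ℓ) - s := by
    unfold rho
    linear_combination -hdiv + hs
  obtain ⟨ht0, hts⟩ := ceil_two_mul_sqrt_le_iff.1 ht.ge
  have htr : t ≤ 2 * r + 1 := ceil_two_mul_sqrt_le_iff.2 ⟨by lia, by nlinarith⟩
  refine IsGreatest.csSup_eq ⟨⟨by lia, ?_⟩, ?_⟩
  · rw [rhoK_nonneg_iff (by lia), hmin]
    refine ⟨t / 2, ⟨by lia, by lia⟩, ?_⟩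
    rw [hterm]
    rcases Int.even_or_odd' t with ⟨c, hc | hc⟩
    · rw [show t / 2 = c by lia]
      nlinarith
    · rw [show t / 2 = c by lia]
      have : s ≤ c * (c + 1) := by
        rw [hc] at hts
        have : 4 * s ≤ 4 * (c * (c + 1)) + 1 := by linarith
        lia
      nlinarith
  · rintro k ⟨-, hk⟩
    rw [rhoK_nonneg_iff (by lia), hmin] at hk
    obtain ⟨ℓ, ⟨hℓ0, -⟩, hk⟩ := hk
    rw [hterm] at hk
    have hpos : 0 < r + q + 2 - k - ℓ := pos_of_mul_pos_right (by lia) hℓ0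
    have := ceil_two_mul_sqrt_le_iff.2
      (⟨by lia, by nlinarith [sq_nonneg (r + q + 2 - k - 2 * ℓ)]⟩ :
        0 ≤ r + q + 2 - k ∧ 4 * s ≤ (r + q + 2 - k) ^ 2)
    lia
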